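/- Let C be a small category and let W be an idempotent comonad on the presheaf category Ĉ = [Cᵒᵖ, Set] (i.e., a comonad whose comultiplication is an isomorphism) whose underlying endofunctor preserves small colimits and finite limits. Then the category F of W-coalgebras is totally distributive; if moreover C has finite limits, then F is lex totally distributive. -/

import Mathlib

open CategoryTheory CategoryTheory.Limits

universe u

/-- A locally small category `E` is *totally distributive* if there exist functors
`t : E ⥤ Ê` and `c : Ê ⥤ E` with adjunctions `t ⊣ c` and `c ⊣ y_E`. -/
def TotallyDistributive (E : Type*) [Category.{u} E] : Prop :=
  ∃ (t : E ⥤ (Eᵒᵖ ⥤ Type u)) (c : (Eᵒᵖ ⥤ Type u) ⥤ E),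
    Nonempty (t ⊣ c) ∧ Nonempty (c ⊣ yoneda)

/-- A locally small category `E` is *lex totally distributive* if moreover the functor
`t` can be chosen to preserve finite limits. -/
def LexTotallyDistributive (E : Type*) [Category.{u} E] : Prop :=
  ∃ (t : E ⥤ (Eᵒᵖ ⥤ Type u)) (c : (Eᵒᵖ ⥤ Type u) ⥤ E),
    Nonempty (t ⊣ c) ∧ Nonempty (c ⊣ yoneda) ∧ PreservesFiniteLimits t

section Presheaf

variable {C : Type u} [SmallCategory C]

/-- The functor `yoneda : Ĉ ⥤ [Ĉᵒᵖ, Set]` is right adjoint to restriction along the Yoneda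
embedding of `C`. -/
noncomputable def restrictYonedaAdjunction :
    (Functor.whiskeringLeft Cᵒᵖ (Cᵒᵖ ⥤ Type u)ᵒᵖ (Type u)).obj yoneda.op ⊣ yoneda :=
  Adjunction.mkOfHomEquiv
    { homEquiv P X :=
        { toFun α :=
            { app Z := ↾fun p ↦
                { app c := ↾fun z ↦ α.app c (P.map (yonedaEquiv.symm z).op p)
                  naturality := by
                    intro c d f
                    ext z
                    have h₁ := yonedaEquiv_symm_naturality_left f.unop Z.unop z
                    have h₂ := α.naturality_apply f (P.map (yonedaEquiv.symm z).op p)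
                    simp at h₁ h₂ ⊢
                    rw [← h₂, ← h₁]
                    simp }
              naturality := by
                intro Z Z' f
                ext p
                simp
                ext c z
                have h := yonedaEquiv_symm_naturality_right c.unop f.unop z
                have h' := congrArg (fun g ↦ α.app c (P.map (Quiver.Hom.op g) p)) h
                simpa using h' }
          invFun β :=
            { app c := ↾fun p ↦ yonedaEquiv (β.app (.op (yoneda.obj c.unop)) p)
              naturality := by
                intro c d f
                ext p
                exact (congrArg yonedaEquiv (β.naturality_apply (yoneda.map f.unop).op p)).trans
                  (yonedaEquiv_naturality _ f.unop).symm }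
          left_inv α := by
            ext c p
            have : yonedaEquiv.symm (𝟙 c.unop) = 𝟙 (yoneda.obj c.unop) :=
              yonedaEquiv.injective (by simp [yonedaEquiv])
            refine (yonedaEquiv_apply _).trans ?_
            change α.app c (P.map (yonedaEquiv.symm (𝟙 c.unop)).op p) = _
            simp [this]
          right_inv β := by
            ext Z p
            simp
            ext c z
            exact (yonedaEquiv_comp (yonedaEquiv.symm z) (β.app Z p)).trans
              (congrArg _ (yonedaEquiv.apply_symm_apply z)) }
      homEquiv_naturality_left_symm := by
        intros
        ext
        simp
      homEquiv_naturality_right := by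
        intros
        ext
        simp
        rfl }

/-- Left Kan extension of presheaves along a flat functor from a small category to a locally
small one preserves finite limits. -/
lemma preservesFiniteLimits_lan_of_flat {D : Type*} [Category.{u} D] (F : C ⥤ D)
    [RepresentablyFlat F] :
    PreservesFiniteLimits (F.op.lan : (Cᵒᵖ ⥤ Type u) ⥤ (Dᵒᵖ ⥤ Type u)) := by
  refine ⟨fun J _ _ ↦ preservesLimitsOfShape_of_evaluation _ J fun K ↦ ?_⟩
  have : IsFiltered (CostructuredArrow F.op K) :=
    IsFiltered.of_equivalence (structuredArrowOpEquivalence F K.unop)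
  have h (G : Cᵒᵖ ⥤ Type u) :
      ∃ e : (F.op.lan.obj G).obj K ≅ colimit (CostructuredArrow.proj F.op K ⋙ G),
        ∀ T : CostructuredArrow F.op K, (F.op.lanUnit.app G).app T.left ≫
          (F.op.lan.obj G).map T.hom ≫ e.hom = colimit.ι (CostructuredArrow.proj F.op K ⋙ G) T :=
    ⟨F.op.leftKanExtensionObjIsoColimit G K,
      F.op.leftKanExtensionUnit_leftKanExtension_map_leftKanExtensionObjIsoColimit_hom G K⟩
  choose e he using h
  let e' : F.op.lan ⋙ (evaluation Dᵒᵖ (Type u)).obj K ≅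
      (Functor.whiskeringLeft _ _ (Type u)).obj (CostructuredArrow.proj F.op K) ⋙ colim :=
    NatIso.ofComponents e fun {G₁ G₂} φ ↦ by
      change (F.op.lan.map φ).app K ≫ (e G₂).hom =
        (e G₁).hom ≫ colimMap (Functor.whiskerLeft (CostructuredArrow.proj F.op K) φ)
      rw [← Iso.inv_comp_eq]
      refine colimit.hom_ext fun T ↦ ?_
      rw [ι_colimMap]
      let t : F.op.obj T.left ⟶ K := T.hom
      let η (G : Cᵒᵖ ⥤ Type u) : G.obj T.left ⟶ (F.op.lan.obj G).obj (F.op.obj T.left) :=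
        (F.op.lanUnit.app G).app T.left
      let j (G : Cᵒᵖ ⥤ Type u) : G.obj T.left ⟶ colimit (CostructuredArrow.proj F.op K ⋙ G) :=
        colimit.ι (CostructuredArrow.proj F.op K ⋙ G) T
      have hj (G : Cᵒᵖ ⥤ Type u) : j G = η G ≫ (F.op.lan.obj G).map t ≫ (e G).hom :=
        (he G T).symm
      have hη : φ.app T.left ≫ η G₂ = η G₁ ≫ (F.op.lan.map φ).app (F.op.obj T.left) :=
        congr_app (F.op.lanUnit.naturality φ) T.left
      change j G₁ ≫ (e G₁).inv ≫ (F.op.lan.map φ).app K ≫ (e G₂).hom = φ.app T.left ≫ j G₂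
      rw [hj, hj, reassoc_of% hη]
      simp
  exact preservesLimitsOfShape_of_natIso e'.symm

lemma totallyDistributive_presheaf : TotallyDistributive (Cᵒᵖ ⥤ Type u) :=
  ⟨_, _, ⟨yoneda.op.lanAdjunction _⟩, ⟨restrictYonedaAdjunction⟩⟩

lemma lexTotallyDistributive_presheaf [HasFiniteLimits C] :
    LexTotallyDistributive (Cᵒᵖ ⥤ Type u) :=
  have : RepresentablyFlat (yoneda (C := C)) := flat_of_preservesFiniteLimits _
  ⟨_, _, ⟨yoneda.op.lanAdjunction _⟩, ⟨restrictYonedaAdjunction⟩,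
    preservesFiniteLimits_lan_of_flat _⟩

end Presheaf

section Triple

variable {D E : Type*} [Category.{u} D] [Category.{u} E] {i : E ⥤ D} {R : D ⥤ E} {S : E ⥤ D}

/-- If `S` is a fully faithful right adjoint of `R : D ⥤ E` and `c` is left adjoint to the Yoneda
embedding of `D`, then restriction along `R`, followed by `c` and `R`, is left adjoint to the
Yoneda embedding of `E`. -/
noncomputable def yonedaAdjunctionOfReflective (adj : R ⊣ S) (hS : S.FullyFaithful)
    {c : (Dᵒᵖ ⥤ Type u) ⥤ D} (h : c ⊣ yoneda) :
    ((Functor.whiskeringLeft _ _ (Type u)).obj R.op ⋙ c) ⋙ R ⊣ yoneda :=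
  (((adj.op.whiskerLeft (Type u)).comp h).comp adj).ofNatIsoRight
    (NatIso.ofComponents (fun X ↦ NatIso.ofComponents fun Y ↦ hS.homEquiv.toIso)).symm

/-- Restricting along `R`, then applying `c` and `R`, is right adjoint to `i`, followed by `t` and
restriction along `i`. -/
def whiskeringAdjunctionOfAdjunction (adj : i ⊣ R)
    {t : D ⥤ (Dᵒᵖ ⥤ Type u)} {c : (Dᵒᵖ ⥤ Type u) ⥤ D} (h : t ⊣ c) :
    i ⋙ t ⋙ (Functor.whiskeringLeft _ _ (Type u)).obj i.op ⊣
      ((Functor.whiskeringLeft _ _ (Type u)).obj R.op ⋙ c) ⋙ R :=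
  adj.comp (h.comp (adj.op.whiskerLeft (Type u)))

lemma TotallyDistributive.of_triple (adj₁ : i ⊣ R) (adj₂ : R ⊣ S) (hi : i.FullyFaithful)
    (hD : TotallyDistributive D) : TotallyDistributive E := by
  obtain ⟨t, c, ⟨h₁⟩, ⟨h₂⟩⟩ := hD
  exact ⟨_, _, ⟨whiskeringAdjunctionOfAdjunction adj₁ h₁⟩, ⟨yonedaAdjunctionOfReflective adj₂
    (Adjunction.Triple.fullyFaithfulEquiv ⟨adj₁, adj₂⟩ hi) h₂⟩⟩

lemma LexTotallyDistributive.of_triple (adj₁ : i ⊣ R) (adj₂ : R ⊣ S) (hi : i.FullyFaithful)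
    [PreservesFiniteLimits i] (hD : LexTotallyDistributive D) : LexTotallyDistributive E := by
  obtain ⟨t, c, ⟨h₁⟩, ⟨h₂⟩, _⟩ := hD
  exact ⟨_, _, ⟨whiskeringAdjunctionOfAdjunction adj₁ h₁⟩, ⟨yonedaAdjunctionOfReflective adj₂
    (Adjunction.Triple.fullyFaithfulEquiv ⟨adj₁, adj₂⟩ hi) h₂⟩, inferInstance⟩

end Triple

namespace CategoryTheory.Comonad

variable {D : Type*} [Category* D] (W : Comonad D)

lemma isIso_coalgebra_a [IsIso W.δ] (A : W.Coalgebra) : IsIso A.a := by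
  have h : W.map (W.ε.app A.A) = W.ε.app (W.obj A.A) := by
    rw [← cancel_epi (W.δ.app A.A), W.right_counit, W.left_counit]
  refine ⟨W.ε.app A.A, A.counit, ?_⟩
  have := W.ε.naturality A.a
  dsimp at this
  rw [← this, ← h, ← Functor.map_comp, A.counit, Functor.map_id]

lemma isIso_adj_unit [IsIso W.δ] : IsIso W.adj.unit := by
  have (A : W.Coalgebra) : IsIso (W.adj.unit.app A) := by
    have : IsIso (W.adj.unit.app A).f := by
      have := W.isIso_coalgebra_a A
      rwa [show (W.adj.unit.app A).f = A.a by simp; rfl]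
    exact W.coalgebra_iso_of_iso _
  exact NatIso.isIso_of_isIso_app _

lemma preservesColimitsOfSize_cofree [PreservesColimitsOfSize.{u, u} W.toFunctor] :
    PreservesColimitsOfSize.{u, u} W.cofree := by
  have : PreservesColimitsOfSize.{u, u} (W.cofree ⋙ W.forget) :=
    inferInstanceAs (PreservesColimitsOfSize.{u, u} W.toFunctor)
  exact preservesColimits_of_reflects_of_preserves W.cofree W.forget

lemma preservesFiniteLimits_forget [PreservesFiniteLimits W.toFunctor] [HasFiniteLimits D] :
    PreservesFiniteLimits W.forget :=
  ⟨fun _ _ _ ↦ inferInstance⟩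

end CategoryTheory.Comonad

/-- Let `C` be a small category and `W` an idempotent comonad on
`Ĉ = [Cᵒᵖ, Set]` (its comultiplication is an isomorphism) whose underlying endofunctor
preserves small colimits and finite limits.  Then the category of `W`-coalgebras is
totally distributive; if moreover `C` has finite limits, it is lex totally
distributive. -/
theorem coalgebras_of_idempotent_cartesian_comonad_totallyDistributive
    {C : Type u} [SmallCategory C] (W : Comonad (Cᵒᵖ ⥤ Type u))
    (hidem : IsIso W.δ)
    [PreservesColimitsOfSize.{u, u} W.toFunctor]
    [PreservesFiniteLimits W.toFunctor] :
    TotallyDistributive (Comonad.Coalgebra W) ∧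
      (HasFiniteLimits C → LexTotallyDistributive (Comonad.Coalgebra W)) := by
  have := W.isIso_adj_unit
  have := W.preservesColimitsOfSize_cofree
  have := W.preservesFiniteLimits_forget
  have hi := W.adj.fullyFaithfulLOfIsIsoUnit
  have : HasColimitsOfSize.{u, u} W.Coalgebra :=
    hasColimits_of_hasColimits_createsColimits W.forget
  have : W.cofree.IsLeftAdjoint := Presheaf.isLeftAdjoint_of_preservesColimits.{u} _
  have adj := Adjunction.ofIsLeftAdjoint W.cofree
  exact ⟨totallyDistributive_presheaf.of_triple W.adj adj hi,
    fun _ ↦ lexTotallyDistributive_presheaf.of_triple W.adj adj hi⟩
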